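/- arXiv:1410.5398 — 2 statements merged into one kernel-verified Lean document; each statement's English description precedes it below -/
import Mathlib

section
/- Let K be a subgroup of ℤ^d of rank d − p, where 0 ≤ p ≤ d, and define N on ℤ^d/K by N(h) = min{‖t‖∞ : t ∈ ℤ^d, t + K = h}. Then for every n ≥ 1 the set H_n := {h ∈ ℤ^d/K : N(h) ≤ n} is finite, and there exists a constant c > 0 such that |H_n| / n^p → c as n → ∞. -/
open Filter Topology MeasureTheory Module

/-- A finitely generated abelian group of rank `p` surjects onto `ℤ^p` with finite kernel. -/
lemma exists_surjective_finite_ker {G : Type*} [AddCommGroup G] [Module.Finite ℤ G] {p : ℕ}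
    (hG : finrank ℤ G = p) :
    ∃ π : G →ₗ[ℤ] (Fin p → ℤ), Function.Surjective π ∧ Finite (LinearMap.ker π) := by
  have hrank : finrank ℤ (G ⧸ Submodule.torsion ℤ G) = p := by
    rw [finrank_quotient_eq_of_le_torsion le_rfl, hG]
  let e := (finBasisOfFinrankEq ℤ (G ⧸ Submodule.torsion ℤ G) hrank).equivFun
  refine ⟨e.toLinearMap ∘ₗ (Submodule.torsion ℤ G).mkQ,
    e.surjective.comp (Submodule.mkQ_surjective _), ?_⟩
  rw [LinearEquiv.ker_comp, Submodule.ker_mkQ]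
  exact Module.finite_of_fg_torsion _ Submodule.torsion_isTorsion

/-- Each fibre of a surjective homomorphism has as many elements as its kernel. -/
lemma card_preimage_of_surjective {G H : Type*} [AddCommGroup G] [AddCommGroup H]
    (π : G →ₗ[ℤ] H) (hπ : Function.Surjective π) (S : Set H) :
    Nat.card (π ⁻¹' S) = Nat.card (LinearMap.ker π) * Nat.card S := by
  rw [← Nat.card_prod]
  refine Nat.card_congr
    { toFun := fun x => (⟨x.1 - Function.surjInv hπ (π x.1), by
        simp [Function.surjInv_eq hπ]⟩, ⟨π x.1, x.2⟩)
      invFun := fun y => ⟨y.1.1 + Function.surjInv hπ y.2.1, by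
        simp [Function.surjInv_eq hπ, LinearMap.mem_ker.1 y.1.2]⟩
      left_inv := fun x => by simp
      right_inv := fun y => by
        ext <;> simp [Function.surjInv_eq hπ, LinearMap.mem_ker.1 y.1.2] }

/-- The number of lattice points in the dilates of a convex body grows like its volume. -/
lemma tendsto_card_lattice_points_dilate {p : ℕ} {P : Set (Fin p → ℝ)} (hconv : Convex ℝ P)
    (hcomp : IsCompact P) :
    Tendsto (fun n : ℕ =>
        (Nat.card {z : Fin p → ℤ | (n : ℝ)⁻¹ • (fun i => (z i : ℝ)) ∈ P} : ℝ) / (n : ℝ) ^ p)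
      atTop (𝓝 (volume.real P)) := by
  have h := tendsto_card_div_pow_atTop_volume P hcomp.isBounded hcomp.measurableSet
    (hconv.addHaar_frontier volume)
  rw [Fintype.card_fin] at h
  refine h.congr' ?_
  filter_upwards [eventually_ne_atTop 0] with n hn
  have hn' : (n : ℝ)⁻¹ ≠ 0 := by positivity
  congr 2
  symm
  refine Nat.card_congr (Equiv.ofBijective
    (fun z => ⟨(n : ℝ)⁻¹ • (fun i => (z.1 i : ℝ)), z.2, ?_⟩) ⟨?_, ?_⟩)
  · refine Set.smul_mem_smul_set ?_
    refine ((Pi.basisFun ℝ (Fin p)).mem_span_iff_repr_mem ℤ _).2 fun i => ⟨z.1 i, by simp⟩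
  · rintro ⟨z, hz⟩ ⟨w, hw⟩ hzw
    have := smul_right_injective _ hn' (Subtype.ext_iff.1 hzw)
    ext i
    simpa using congrFun this i
  · rintro ⟨x, hx, y, hy, rfl⟩
    have hy' := ((Pi.basisFun ℝ (Fin p)).mem_span_iff_repr_mem ℤ _).1 hy
    choose z hz using hy'
    have hzy : (fun i => (z i : ℝ)) = y := by
      ext i
      simpa using hz i
    exact ⟨⟨z, by simpa [hzy] using hx⟩, by simp [hzy]⟩

/-- The real extension of an integral linear map between standard lattices. -/
noncomputable def realExtension {d p : ℕ} (φ : (Fin d → ℤ) →ₗ[ℤ] (Fin p → ℤ)) :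
    (Fin d → ℝ) →ₗ[ℝ] (Fin p → ℝ) :=
  Fintype.linearCombination ℝ fun i j => (φ (Pi.single i 1) j : ℝ)

lemma realExtension_apply {d p : ℕ} (φ : (Fin d → ℤ) →ₗ[ℤ] (Fin p → ℤ)) (x : Fin d → ℝ)
    (j : Fin p) : realExtension φ x j = ∑ i, x i * (φ (Pi.single i 1) j : ℝ) := by
  simp [realExtension, Fintype.linearCombination_apply]

lemma realExtension_intCast {d p : ℕ} (φ : (Fin d → ℤ) →ₗ[ℤ] (Fin p → ℤ)) (t : Fin d → ℤ) :
    realExtension φ (fun i => (t i : ℝ)) = fun j => (φ t j : ℝ) := by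
  ext j
  rw [realExtension_apply]
  conv_rhs => rw [pi_eq_sum_univ' t]
  simp only [map_sum, map_smul, Finset.sum_apply, Pi.smul_apply, smul_eq_mul]
  push_cast
  rfl

lemma realExtension_surjective {d p : ℕ} {φ : (Fin d → ℤ) →ₗ[ℤ] (Fin p → ℤ)}
    (hφ : Function.Surjective φ) : Function.Surjective (realExtension φ) := by
  intro y
  choose s hs using fun j : Fin p => hφ (Pi.single j 1)
  refine ⟨∑ j, y j • fun i => (s j i : ℝ), ?_⟩
  ext k
  simp [map_sum, realExtension_intCast, hs, Finset.sum_apply, Pi.single_apply]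

/-- If `φ` is surjective and `K` contains `m • ker φ` for some `m > 0`, then every integer vector with the
same image as a real vector `x` is congruent modulo `K` to one uniformly close to `x`. -/
lemma exists_sub_mem_abs_sub_le {d p : ℕ} {φ : (Fin d → ℤ) →ₗ[ℤ] (Fin p → ℤ)}
    (hφ : Function.Surjective φ) (K : AddSubgroup (Fin d → ℤ)) {m : ℕ} (hm : 0 < m)
    (hK : ∀ t, φ t = 0 → m • t ∈ K) :
    ∃ C : ℕ, ∀ (t : Fin d → ℤ) (x : Fin d → ℝ),
      realExtension φ x = (fun j => (φ t j : ℝ)) →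
      ∃ k ∈ K, ∀ j, |((t - k) j : ℝ) - x j| ≤ C := by
  choose s hs using fun j : Fin p => hφ (Pi.single j 1)
  set v : Fin d → (Fin d → ℤ) := fun i =>
    Pi.single i 1 - ∑ l, φ (Pi.single i 1) l • s l with hv
  have hφv : ∀ i, φ (v i) = 0 := by
    intro i
    ext l
    simp only [hv, map_sub, map_sum, map_smul, hs]
    simp [Finset.sum_apply, Pi.single_apply]
  refine ⟨∑ j, ∑ i, m * (v i j).natAbs, fun t x hx => ?_⟩
  set y : Fin d → ℝ := fun i => (t i : ℝ) - x i with hy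
  have hφy : ∀ l, ∑ i, y i * (φ (Pi.single i 1) l : ℝ) = 0 := by
    intro l
    have h1 := congrFun hx l
    have h2 := congrFun (realExtension_intCast φ t) l
    rw [realExtension_apply] at h1 h2
    simp only [hy, sub_mul, Finset.sum_sub_distrib]
    linarith
  have hyv : ∀ j, y j = ∑ i, y i * (v i j : ℝ) := by
    intro j
    have : ∑ i, y i * ∑ l, (φ (Pi.single i 1) l : ℝ) * (s l j : ℝ) = 0 := by
      simp only [Finset.mul_sum]
      rw [Finset.sum_comm]
      refine Finset.sum_eq_zero fun l _ => ?_
      simp only [← mul_assoc, ← Finset.sum_mul, hφy, zero_mul]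
    simp only [hv, Pi.sub_apply, Finset.sum_apply, Pi.smul_apply, smul_eq_mul]
    push_cast
    simp only [mul_sub, Finset.sum_sub_distrib, this, sub_zero]
    simp [Pi.single_apply]
  have hm' : (0 : ℝ) < m := by positivity
  refine ⟨∑ i, ⌊y i / m⌋ • (m • v i),
    K.sum_mem fun i _ => K.zsmul_mem (hK _ (hφv i)) _, fun j => ?_⟩
  have key : (((t - ∑ i, ⌊y i / m⌋ • (m • v i)) j : ℤ) : ℝ) - x j
      = ∑ i, (m * Int.fract (y i / m)) * (v i j : ℝ) := by
    have : ∀ i, (m * Int.fract (y i / m)) * (v i j : ℝ)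
        = y i * (v i j : ℝ) - ⌊y i / m⌋ * (m * (v i j : ℝ)) := by
      intro i
      rw [Int.fract]
      field_simp
    simp only [this, Finset.sum_sub_distrib, ← hyv]
    simp [Finset.sum_apply, hy]
    ring
  rw [key]
  calc |∑ i, (m * Int.fract (y i / m)) * (v i j : ℝ)|
      ≤ ∑ i, |(m * Int.fract (y i / m)) * (v i j : ℝ)| := Finset.abs_sum_le_sum_abs _ _
    _ ≤ ∑ i, ((m * (v i j).natAbs : ℕ) : ℝ) := by
        refine Finset.sum_le_sum fun i _ => ?_
        rw [abs_mul, abs_of_nonneg (mul_nonneg hm'.le (Int.fract_nonneg _))]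
        push_cast
        rw [Nat.cast_natAbs, Int.cast_abs]
        gcongr
        exact mul_le_of_le_one_right hm'.le (Int.fract_lt_one _).le
    _ ≤ _ := by
        rw [← Nat.cast_sum]
        exact_mod_cast Finset.single_le_sum
          (f := fun j => ∑ i, m * (v i j).natAbs) (fun _ _ => Nat.zero_le _) (Finset.mem_univ j)

lemma tendsto_nat_add_div_atTop_one (C : ℕ) :
    Tendsto (fun n : ℕ => (n : ℝ) / ((n + C : ℕ) : ℝ)) atTop (𝓝 1) := by
  simpa using tendsto_natCast_div_add_atTop (C : ℝ)

lemma tendsto_div_pow_of_shifted_bounds {A f : ℕ → ℕ} {p T C : ℕ} {V : ℝ}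
    (hA : Tendsto (fun n : ℕ => (A n : ℝ) / (n : ℝ) ^ p) atTop (𝓝 V))
    (hle : ∀ n, 1 ≤ n → f n ≤ T * A n) (hge : ∀ n, 1 ≤ n → T * A n ≤ f (n + C)) :
    Tendsto (fun n : ℕ => (f n : ℝ) / (n : ℝ) ^ p) atTop (𝓝 (T * V)) := by
  rw [← tendsto_add_atTop_iff_nat C]
  have hup : Tendsto (fun n : ℕ => (T : ℝ) * ((A (n + C) : ℝ) / ((n + C : ℕ) : ℝ) ^ p)) atTop
      (𝓝 (T * V)) :=
    ((tendsto_add_atTop_iff_nat C).2 hA).const_mul _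
  have hlow : Tendsto (fun n : ℕ =>
      (T : ℝ) * ((A n : ℝ) / (n : ℝ) ^ p * ((n : ℝ) / ((n + C : ℕ) : ℝ)) ^ p)) atTop
      (𝓝 (T * V)) := by
    simpa using (hA.mul ((tendsto_nat_add_div_atTop_one C).pow p)).const_mul (T : ℝ)
  refine tendsto_of_tendsto_of_tendsto_of_le_of_le' hlow hup ?_ ?_
  · filter_upwards [eventually_ge_atTop 1] with n hn
    have hn' : (n : ℝ) ≠ 0 := by positivity
    have h : ((T * A n : ℕ) : ℝ) ≤ f (n + C) := by exact_mod_cast hge n hn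
    rw [div_pow, div_mul_div_cancel₀ (pow_ne_zero _ hn'), ← mul_div_assoc]
    push_cast at h ⊢
    gcongr
  · filter_upwards [eventually_ge_atTop 1] with n hn
    have h : (f (n + C) : ℝ) ≤ (T * A (n + C) : ℕ) := by exact_mod_cast hle _ (by omega)
    rw [← mul_div_assoc]
    push_cast at h ⊢
    gcongr

/-- The quotient of `ℤ^d` by a subgroup of rank `d - p` has rank `p`. -/
lemma finrank_quotient_of_equiv {d p : ℕ} (hp : p ≤ d) (K : AddSubgroup (Fin d → ℤ))
    (e : K ≃+ (Fin (d - p) → ℤ)) : finrank ℤ ((Fin d → ℤ) ⧸ K) = p := by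
  have h := Submodule.finrank_quotient_add_finrank (AddSubgroup.toIntSubmodule K)
  have hK : finrank ℤ (AddSubgroup.toIntSubmodule K) = d - p := by
    simpa using LinearEquiv.finrank_eq (show AddSubgroup.toIntSubmodule K ≃ₗ[ℤ] _ from
      e.toIntLinearEquiv)
  rw [hK, finrank_fin_fun] at h
  have h' : finrank ℤ ((Fin d → ℤ) ⧸ AddSubgroup.toIntSubmodule K) = p := by omega
  exact h'

lemma quotient_norm_le_iff {d : ℕ} {K : AddSubgroup (Fin d → ℤ)} {N : ((Fin d → ℤ) ⧸ K) → ℕ}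
    (hN : ∀ h : (Fin d → ℤ) ⧸ K,
      N h = sInf ((fun t : Fin d → ℤ => Finset.univ.sup fun i => (t i).natAbs) ''
        {t : Fin d → ℤ | (QuotientAddGroup.mk t : (Fin d → ℤ) ⧸ K) = h}))
    (h : (Fin d → ℤ) ⧸ K) (n : ℕ) :
    N h ≤ n ↔ ∃ t : Fin d → ℤ, (QuotientAddGroup.mk t : (Fin d → ℤ) ⧸ K) = h ∧
      ∀ i, (t i).natAbs ≤ n := by
  rw [hN]
  constructor
  · intro hn
    obtain ⟨t₀, ht₀⟩ := QuotientAddGroup.mk_surjective h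
    obtain ⟨t, ht, hinf⟩ := Nat.sInf_mem (Set.Nonempty.image
      (fun t : Fin d → ℤ => Finset.univ.sup fun i => (t i).natAbs) (s := {t : Fin d → ℤ |
        (QuotientAddGroup.mk t : (Fin d → ℤ) ⧸ K) = h}) ⟨t₀, ht₀⟩)
    rw [← hinf] at hn
    exact ⟨t, ht, fun i => (Finset.le_sup (f := fun i => (t i).natAbs)
      (Finset.mem_univ i)).trans hn⟩
  · rintro ⟨t, ht, hn⟩
    exact (Nat.sInf_le (Set.mem_image_of_mem (fun t : Fin d → ℤ =>
      Finset.univ.sup fun i => (t i).natAbs) ht)).trans (Finset.sup_le fun i _ => hn i)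

lemma finite_natAbs_le (d n : ℕ) : {t : Fin d → ℤ | ∀ i, (t i).natAbs ≤ n}.Finite := by
  refine (Set.finite_Icc (fun _ => -(n : ℤ)) (fun _ => (n : ℤ))).subset fun t ht => ?_
  exact ⟨fun i => by have := ht i; simp only; omega, fun i => by have := ht i; simp only; omega⟩

/-- If `K ≤ ℤ^d` has rank `d − p` (`0 ≤ p ≤ d`) and
`N(h) := min{‖t‖∞ : t + K = h}`, then each `H_n := {h : N(h) ≤ n}` is finite and
`|H_n| / n^p` converges to a strictly positive constant. -/
theorem stmt_4 (d p : ℕ) (hp : p ≤ d) (K : AddSubgroup (Fin d → ℤ))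
    (hK : Nonempty (K ≃+ (Fin (d - p) → ℤ)))
    (N : ((Fin d → ℤ) ⧸ K) → ℕ)
    (hN : ∀ h : (Fin d → ℤ) ⧸ K,
      N h = sInf ((fun t : Fin d → ℤ => Finset.univ.sup fun i => (t i).natAbs) ''
        {t : Fin d → ℤ | (QuotientAddGroup.mk t : (Fin d → ℤ) ⧸ K) = h})) :
    (∀ n : ℕ, 1 ≤ n → {h : (Fin d → ℤ) ⧸ K | N h ≤ n}.Finite) ∧
    ∃ c : ℝ, 0 < c ∧
      Filter.Tendsto
        (fun n : ℕ => (Nat.card {h : (Fin d → ℤ) ⧸ K | N h ≤ n} : ℝ) / (n : ℝ) ^ p)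
        Filter.atTop (nhds c) := by
  have hfin : ∀ n : ℕ, {h : (Fin d → ℤ) ⧸ K | N h ≤ n}.Finite := fun n =>
    ((finite_natAbs_le d n).image QuotientAddGroup.mk).subset fun h hh => by
      obtain ⟨t, ht, hn⟩ := (quotient_norm_le_iff hN h n).1 hh
      exact ⟨t, hn, ht⟩
  refine ⟨fun n _ => hfin n, ?_⟩
  obtain ⟨e⟩ := hK
  let q : (Fin d → ℤ) →ₗ[ℤ] ((Fin d → ℤ) ⧸ K) := (QuotientAddGroup.mk' K).toIntLinearMap
  have hq : Function.Surjective q := QuotientAddGroup.mk_surjective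
  have : Module.Finite ℤ ((Fin d → ℤ) ⧸ K) := Module.Finite.of_surjective q hq
  obtain ⟨π, hπ, hker⟩ := exists_surjective_finite_ker (finrank_quotient_of_equiv hp K e)
  set φ := π ∘ₗ q with hφdef
  have hφ : Function.Surjective φ := hπ.comp hq
  obtain ⟨C, hC⟩ := exists_sub_mem_abs_sub_le hφ K (m := Nat.card (LinearMap.ker π))
    Nat.card_pos fun t ht => by
      have h := congrArg Subtype.val (card_nsmul_eq_zero' (x := (⟨q t, ht⟩ : LinearMap.ker π)))
      rw [← QuotientAddGroup.eq_zero_iff]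
      exact (map_nsmul q _ t).trans h
  set P : Set (Fin p → ℝ) := realExtension φ '' Metric.closedBall 0 1 with hP
  have hcont : Continuous (realExtension φ) := LinearMap.continuous_of_finiteDimensional _
  have hconv : Convex ℝ P := (convex_closedBall 0 1).linear_image _
  have hcomp : IsCompact P := (isCompact_closedBall 0 1).image hcont
  have hpos : 0 < volume.real P := by
    refine ENNReal.toReal_pos ?_ hcomp.measure_lt_top.ne
    have hopen := (realExtension φ).isOpenMap_of_finiteDimensional (realExtension_surjective hφ)
      _ (Metric.isOpen_ball (x := (0 : Fin d → ℝ)) (ε := 1))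
    exact ((hopen.measure_pos volume ((Metric.nonempty_ball.2 one_pos).image _)).trans_le
      (measure_mono (Set.image_mono Metric.ball_subset_closedBall))).ne'
  have hinner : ∀ n : ℕ, 1 ≤ n → ∀ h, N h ≤ n →
      (n : ℝ)⁻¹ • (fun i => (π h i : ℝ)) ∈ P := by
    intro n hn h hh
    have hn0 : (0 : ℝ) < n := by positivity
    obtain ⟨t, rfl, ht⟩ := (quotient_norm_le_iff hN h n).1 hh
    refine ⟨(n : ℝ)⁻¹ • fun i => (t i : ℝ), ?_, ?_⟩
    · rw [mem_closedBall_zero_iff, pi_norm_le_iff_of_nonneg zero_le_one]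
      intro i
      have hi : |(t i : ℝ)| ≤ n := by
        rw [← Int.cast_abs, ← Nat.cast_natAbs]
        exact_mod_cast ht i
      rw [Pi.smul_apply, smul_eq_mul, Real.norm_eq_abs, abs_mul, abs_of_pos (inv_pos.2 hn0)]
      exact inv_mul_le_one_of_le₀ hi hn0.le
    · rw [map_smul, realExtension_intCast]
      rfl
  have houter : ∀ n : ℕ, 1 ≤ n → ∀ h, (n : ℝ)⁻¹ • (fun i => (π h i : ℝ)) ∈ P →
      N h ≤ n + C := by
    rintro n hn h ⟨u, hu, huh⟩
    have hn0 : (n : ℝ) ≠ 0 := by positivity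
    obtain ⟨t, rfl⟩ := QuotientAddGroup.mk_surjective h
    obtain ⟨k, hk, hle⟩ := hC t ((n : ℝ) • u) (by
      rw [map_smul, huh, smul_inv_smul₀ hn0]
      rfl)
    refine (quotient_norm_le_iff hN _ _).2 ⟨t - k, ?_, fun i => ?_⟩
    · rw [QuotientAddGroup.mk_sub, (QuotientAddGroup.eq_zero_iff k).2 hk, sub_zero]
    · have hui : |u i| ≤ 1 := (norm_le_pi_norm u i).trans (mem_closedBall_zero_iff.1 hu)
      have hnu : |(n : ℝ) * u i| ≤ n := by
        rw [abs_mul, Nat.abs_cast]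
        exact mul_le_of_le_one_right (Nat.cast_nonneg _) hui
      have hi := hle i
      rw [Pi.smul_apply, smul_eq_mul] at hi
      have h : |((t - k) i : ℝ)| ≤ n + C := by
        have := abs_add_le (((t - k) i : ℝ) - n * u i) (n * u i)
        rw [sub_add_cancel] at this
        linarith
      rw [← Int.cast_abs, ← Nat.cast_natAbs] at h
      exact_mod_cast h
  have hT : 0 < Nat.card (LinearMap.ker π) := Nat.card_pos
  refine ⟨Nat.card (LinearMap.ker π) * volume.real P, by positivity,
    tendsto_div_pow_of_shifted_bounds (C := C) (tendsto_card_lattice_points_dilate hconv hcomp)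
      (fun n hn => ?_) (fun n hn => ?_)⟩
  all_goals rw [← card_preimage_of_surjective π hπ]
  · exact Nat.card_mono ((hfin (n + C)).subset (houter n hn)) (hinner n hn)
  · exact Nat.card_mono (hfin (n + C)) (houter n hn)
end

section
/- Let K be a subgroup of ℤ^d of rank d − p with 1 ≤ p < d, let G := ℤ^d/K with projection π : ℤ^d → G, define N(h) := min{‖t‖∞ : t ∈ ℤ^d, π(t) = h} for h ∈ G, H_n := {h ∈ G : N(h) ≤ n}, and m(s,n) := #{t ∈ ℤ^d : ‖t‖∞ ≤ n, π(t) = s}. Let (W, 𝒲, ν) be a σ-finite measure space, α ∈ (0,2), and let h : W × G → ℝ be jointly measurable such that ∫_W Σ_{j ∈ G} |h(v,j)|^α ν(dv) < ∞ and ∫_W (Σ_{j ∈ G} |h(v,j)|)^α ν(dv) < ∞. For integers T ≥ 1 and n ≥ 1 define σ_{T,n}^α := ∫_W Σ_{u ∈ G} | Σ_{s ∈ H_n} m(s,n) h(v, u + s) 𝟙{N(u + s) > T} |^α ν(dv). Then lim_{T→∞} limsup_{n→∞} σ_{T,n}^α / n^{p + α(d−p)} = 0. -/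
open MeasureTheory ENNReal Filter
open scoped Classical

/-- The integer points of the cube of radius `n` for the sup norm. -/
noncomputable def intCube (ι : Type*) [Fintype ι] (n : ℕ) : Finset (ι → ℤ) :=
  Finset.Icc (fun _ => -(n : ℤ)) (fun _ => (n : ℤ))

lemma mem_intCube {ι : Type*} [Fintype ι] {n : ℕ} {t : ι → ℤ} :
    t ∈ intCube ι n ↔ ∀ i, |t i| ≤ n := by
  simp only [intCube, Finset.mem_Icc, Pi.le_def, abs_le]
  exact forall_and.symm

lemma mem_intCube_iff_sup_natAbs_le {ι : Type*} [Fintype ι] {n : ℕ} {t : ι → ℤ} :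
    t ∈ intCube ι n ↔ (Finset.univ.sup fun i => (t i).natAbs) ≤ n := by
  rw [mem_intCube, Finset.sup_le_iff]
  refine ⟨fun H i _ => ?_, fun H i => ?_⟩
  · have := H i
    rw [Int.abs_eq_natAbs] at this
    exact_mod_cast this
  · rw [Int.abs_eq_natAbs]
    exact_mod_cast H i (Finset.mem_univ i)

lemma card_intCube (ι : Type*) [Fintype ι] (n : ℕ) :
    (intCube ι n).card = (2 * n + 1) ^ Fintype.card ι := by
  rw [intCube, Pi.card_Icc]
  simp only [Int.card_Icc, Finset.prod_const, Finset.card_univ]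
  congr 1
  omega

lemma intCube_mono (ι : Type*) [Fintype ι] : Monotone (intCube ι) := by
  intro a b hab t ht
  rw [mem_intCube] at ht ⊢
  exact fun i => (ht i).trans (by exact_mod_cast hab)

lemma exists_map_mem_intCube {ι κ : Type*} [Fintype ι] [Fintype κ]
    (φ : (ι → ℤ) →+ (κ → ℤ)) :
    ∃ B : ℕ, 1 ≤ B ∧ ∀ n, ∀ a ∈ intCube ι n, φ a ∈ intCube κ (B * n) := by
  refine ⟨(∑ j, ∑ i, (φ (Pi.single i 1) j).natAbs) + 1, by omega, fun n a ha => ?_⟩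
  rw [mem_intCube] at ha ⊢
  intro j
  have h1 : φ a j = ∑ i, a i * φ (Pi.single i 1) j := by
    have h2 : a = ∑ i, a i • (Pi.single i 1 : ι → ℤ) := by
      ext k
      simp [Finset.sum_apply, Pi.single_apply]
    conv_lhs => rw [h2]
    simp [map_sum, Finset.sum_apply, -zsmul_eq_mul]
  rw [h1]
  calc |∑ i, a i * φ (Pi.single i 1) j| ≤ ∑ i, |a i * φ (Pi.single i 1) j| :=
        Finset.abs_sum_le_sum_abs _ _
    _ ≤ ∑ i, (n : ℤ) * |φ (Pi.single i 1) j| := by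
        refine Finset.sum_le_sum fun i _ => ?_
        rw [abs_mul]
        exact mul_le_mul_of_nonneg_right (ha i) (abs_nonneg _)
    _ = (∑ i, |φ (Pi.single i 1) j|) * n := by rw [← Finset.mul_sum, mul_comm]
    _ ≤ (∑ j, ∑ i, |φ (Pi.single i 1) j|) * n := by
        refine mul_le_mul_of_nonneg_right ?_ (by positivity)
        exact Finset.single_le_sum (f := fun j => ∑ i, |φ (Pi.single i 1) j|)
          (fun j _ => Finset.sum_nonneg fun i _ => abs_nonneg _) (Finset.mem_univ j)
    _ ≤ _ := by
        push_cast
        exact mul_le_mul_of_nonneg_right (by omega) (by positivity)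

lemma exists_mem_intCube_of_map_mem {ι κ : Type*} [Fintype ι] [Fintype κ]
    (φ : (ι → ℤ) →+ (κ → ℤ)) (hφ : Function.Injective φ) :
    ∃ B : ℕ, ∀ n, ∀ a, φ a ∈ intCube κ n → a ∈ intCube ι (B * n) := by
  let c : (κ → ℤ) →ₗ[ℤ] (κ → ℚ) := (Int.castAddHom ℚ).toIntLinearMap.compLeft κ
  have hc : Function.Injective c := fun x y hxy => by
    ext j
    have := congrFun hxy j
    simpa [c] using this
  have hli : LinearIndependent ℚ fun i : ι => c (φ (Pi.single i 1)) := by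
    rw [← LinearIndependent.iff_fractionRing ℤ ℚ]
    have h1 := (Pi.basisFun ℤ ι).linearIndependent.map' (c ∘ₗ φ.toIntLinearMap)
      (LinearMap.ker_eq_bot.2 (hc.comp hφ))
    have h2 : (fun i : ι => c (φ (Pi.single i 1))) =
        (c ∘ₗ φ.toIntLinearMap) ∘ (Pi.basisFun ℤ ι) := by
      ext i j
      simp
    rw [h2]
    exact h1
  obtain ⟨L, hL⟩ := LinearMap.exists_leftInverse_of_injective
    (Fintype.linearCombination ℚ fun i : ι => c (φ (Pi.single i 1)))
    (LinearMap.ker_eq_bot.2 hli.fintypeLinearCombination_injective)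
  have hLφ : ∀ a : ι → ℤ, L (c (φ a)) = fun i => (a i : ℚ) := by
    intro a
    have h1 : Fintype.linearCombination ℚ (fun i : ι => c (φ (Pi.single i 1)))
        (fun i => (a i : ℚ)) = c (φ a) := by
      rw [Fintype.linearCombination_apply]
      have h2 : a = ∑ i, a i • (Pi.single i 1 : ι → ℤ) := by
        ext k
        simp [Finset.sum_apply, Pi.single_apply]
      conv_rhs => rw [h2]
      simp only [map_sum, map_zsmul, Int.cast_smul_eq_zsmul]
    rw [← h1]
    exact LinearMap.congr_fun hL _
  obtain ⟨B, hB⟩ := exists_nat_ge (∑ i, ∑ j, |L (fun k => if j = k then 1 else 0) i|)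
  refine ⟨B, fun n a ha => ?_⟩
  rw [mem_intCube] at ha ⊢
  intro i
  have h1 : (a i : ℚ) = ∑ j, (φ a j : ℚ) * L (fun k => if j = k then 1 else 0) i := by
    rw [← congrFun (hLφ a) i, LinearMap.pi_apply_eq_sum_univ L]
    simp [Finset.sum_apply, c]
  have h2 : |(a i : ℚ)| ≤ B * n := by
    rw [h1]
    calc _ ≤ ∑ j, |(φ a j : ℚ) * L (fun k => if j = k then 1 else 0) i| :=
          Finset.abs_sum_le_sum_abs _ _
      _ ≤ ∑ j, (n : ℚ) * |L (fun k => if j = k then 1 else 0) i| := by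
          refine Finset.sum_le_sum fun j _ => ?_
          rw [abs_mul]
          exact mul_le_mul_of_nonneg_right (by exact_mod_cast ha j) (abs_nonneg _)
      _ = (∑ j, |L (fun k => if j = k then 1 else 0) i|) * n := by
          rw [← Finset.mul_sum, mul_comm]
      _ ≤ B * n := by
          refine mul_le_mul_of_nonneg_right (le_trans ?_ hB) (by positivity)
          exact Finset.single_le_sum
            (f := fun i => ∑ j, |L (fun k => if j = k then 1 else 0) i|)
            (fun j _ => Finset.sum_nonneg fun i _ => abs_nonneg _) (Finset.mem_univ i)
  exact_mod_cast h2

section Cosets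

variable {d r : ℕ} {K : AddSubgroup (Fin d → ℤ)}

/-- The number of points of the cube of radius `n` in a given coset. -/
noncomputable def cosetCount (K : AddSubgroup (Fin d → ℤ)) (n : ℕ) (s : (Fin d → ℤ) ⧸ K) : ℕ :=
  ((intCube (Fin d) n).filter fun t => (QuotientAddGroup.mk t : (Fin d → ℤ) ⧸ K) = s).card

/-- The cosets meeting the cube of radius `n`. -/
noncomputable def cosetCube (K : AddSubgroup (Fin d → ℤ)) (n : ℕ) : Finset ((Fin d → ℤ) ⧸ K) :=
  (intCube (Fin d) n).image QuotientAddGroup.mk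

lemma cosetCount_eq_zero {n : ℕ} {s : (Fin d → ℤ) ⧸ K} (hs : s ∉ cosetCube K n) :
    cosetCount K n s = 0 := by
  rw [cosetCount, Finset.card_eq_zero, Finset.filter_eq_empty_iff]
  intro t ht hts
  exact hs (Finset.mem_image.2 ⟨t, ht, hts⟩)

lemma exists_cosetCount_le (e : K ≃+ (Fin r → ℤ)) :
    ∃ C : ℕ, ∀ n, 1 ≤ n → ∀ s, cosetCount K n s ≤ C * n ^ r := by
  obtain ⟨B, hB⟩ := exists_mem_intCube_of_map_mem (K.subtype.comp e.symm.toAddMonoidHom)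
    (Subtype.val_injective.comp e.symm.injective)
  refine ⟨(4 * B + 1) ^ r, fun n hn s => ?_⟩
  rcases Finset.eq_empty_or_nonempty ((intCube (Fin d) n).filter
    fun t => (QuotientAddGroup.mk t : (Fin d → ℤ) ⧸ K) = s) with h0 | ⟨t₀, ht₀⟩
  · simp [cosetCount, h0]
  rw [Finset.mem_filter] at ht₀
  have hsub : (intCube (Fin d) n).filter
      (fun t => (QuotientAddGroup.mk t : (Fin d → ℤ) ⧸ K) = s) ⊆
      (intCube (Fin r) (B * (2 * n))).image fun a => t₀ + (e.symm a : Fin d → ℤ) := by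
    intro t ht
    rw [Finset.mem_filter] at ht
    have hk : -t₀ + t ∈ K := QuotientAddGroup.eq.1 (ht₀.2.trans ht.2.symm)
    refine Finset.mem_image.2 ⟨e ⟨_, hk⟩, hB _ _ ?_, by simp⟩
    rw [mem_intCube]
    intro i
    have h1 := mem_intCube.1 ht₀.1 i
    have h2 := mem_intCube.1 ht.1 i
    simp only [AddMonoidHom.comp_apply, AddEquiv.coe_toAddMonoidHom, AddEquiv.symm_apply_apply,
      AddSubgroup.coe_subtype, Pi.add_apply, Pi.neg_apply]
    rw [abs_le] at *
    push_cast
    constructor <;> linarith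
  calc cosetCount K n s ≤ (intCube (Fin r) (B * (2 * n))).card :=
        (Finset.card_le_card hsub).trans Finset.card_image_le
    _ = (2 * (B * (2 * n)) + 1) ^ r := by rw [card_intCube, Fintype.card_fin]
    _ ≤ ((4 * B + 1) * n) ^ r := Nat.pow_le_pow_left (by nlinarith) r
    _ = _ := mul_pow _ _ _

lemma exists_card_cosetCube_le (e : K ≃+ (Fin r → ℤ)) (hr : r ≤ d) :
    ∃ C : ℕ, ∀ n, 1 ≤ n → (cosetCube K n).card ≤ C * n ^ (d - r) := by
  obtain ⟨B, hB1, hB⟩ := exists_map_mem_intCube (K.subtype.comp e.symm.toAddMonoidHom)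
  refine ⟨B ^ r * 5 ^ d, fun n hn => ?_⟩
  have hfib : ∀ s ∈ cosetCube K n, (2 * (n / B) + 1) ^ r ≤ cosetCount K (2 * n) s := by
    intro s hs
    obtain ⟨t₀, ht₀, rfl⟩ := Finset.mem_image.1 hs
    have := card_intCube (Fin r) (n / B)
    rw [Fintype.card_fin] at this
    rw [← this]
    refine Finset.card_le_card_of_injOn (fun a => t₀ + (e.symm a : Fin d → ℤ)) ?_ ?_
    · intro a ha
      simp only [Finset.coe_filter, Set.mem_ofPred_eq]
      refine ⟨?_, ?_⟩
      · have h1 := mem_intCube.1 (hB _ a ha)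
        have h2 := mem_intCube.1 ht₀
        rw [mem_intCube]
        intro i
        have h1 := h1 i
        have h2 := h2 i
        simp only [AddMonoidHom.comp_apply, AddEquiv.coe_toAddMonoidHom,
          AddSubgroup.coe_subtype] at h1
        have h3 : ((B * (n / B) : ℕ) : ℤ) ≤ n := by exact_mod_cast Nat.mul_div_le n B
        have h4 := (abs_add_le (t₀ i) ((e.symm a : Fin d → ℤ) i))
        simp only [Pi.add_apply]
        push_cast at *
        linarith
      · refine (QuotientAddGroup.eq.2 ?_).symm
        simp
    · intro a _ b _ hab
      exact e.symm.injective (Subtype.val_injective (add_left_cancel hab))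
  have hsum : ∑ s ∈ cosetCube K n, cosetCount K (2 * n) s ≤ (4 * n + 1) ^ d := by
    have h1 : (cosetCube K n) ⊆ cosetCube K (2 * n) :=
      Finset.image_subset_image (intCube_mono _ (by omega))
    calc _ ≤ ∑ s ∈ cosetCube K (2 * n), cosetCount K (2 * n) s :=
          Finset.sum_le_sum_of_subset h1
      _ = (intCube (Fin d) (2 * n)).card :=
          (Finset.card_eq_sum_card_fiberwise fun t ht => Finset.mem_image_of_mem _ ht).symm
      _ = _ := by
          rw [card_intCube, Fintype.card_fin]
          ring
  have hlow : n ≤ B * (2 * (n / B) + 1) := by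
    have h1 := Nat.div_add_mod n B
    have h2 := Nat.mod_lt n hB1
    nlinarith [Nat.zero_le (B * (n / B))]
  refine Nat.le_of_mul_le_mul_right (c := n ^ r) ?_ (by positivity)
  calc (cosetCube K n).card * n ^ r
      ≤ (cosetCube K n).card * (B * (2 * (n / B) + 1)) ^ r := by gcongr
    _ = B ^ r * ((cosetCube K n).card • (2 * (n / B) + 1) ^ r) := by
        rw [mul_pow, smul_eq_mul]
        ring
    _ ≤ B ^ r * (4 * n + 1) ^ d := by
        gcongr
        exact (Finset.card_nsmul_le_sum _ _ _ hfib).trans hsum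
    _ ≤ B ^ r * (5 * n) ^ d := by
        gcongr
        omega
    _ = B ^ r * 5 ^ d * n ^ (d - r) * n ^ r := by
        rw [mul_pow, mul_assoc _ (n ^ (d - r)), ← pow_add, Nat.sub_add_cancel hr, mul_assoc]

end Cosets

lemma ENNReal.rpow_sum_le_sum_rpow {ι : Type*} (S : Finset ι) (f : ι → ℝ≥0∞) {α : ℝ}
    (h0 : 0 < α) (h1 : α ≤ 1) : (∑ i ∈ S, f i) ^ α ≤ ∑ i ∈ S, f i ^ α :=
  Finset.le_sum_of_subadditive (fun x : ℝ≥0∞ => x ^ α) (by simp [h0])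
    (fun x y => ENNReal.rpow_add_le_add_rpow x y h0.le h1) S f

lemma ENNReal.rpow_sum_mul_le {ι : Type*} (S : Finset ι) (w f : ι → ℝ≥0∞) {α : ℝ}
    (h1 : 1 ≤ α) :
    (∑ i ∈ S, w i * f i) ^ α ≤ (∑ i ∈ S, w i) ^ (α - 1) * ∑ i ∈ S, w i * f i ^ α := by
  have h0 : 0 < α := by linarith
  refine (ENNReal.rpow_le_rpow (ENNReal.inner_le_weight_mul_Lp_of_nonneg S h1 w f) h0.le).trans ?_
  rw [ENNReal.mul_rpow_of_nonneg _ _ h0.le, ← ENNReal.rpow_mul, ← ENNReal.rpow_mul,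
    inv_mul_cancel₀ h0.ne', ENNReal.rpow_one, sub_mul, inv_mul_cancel₀ h0.ne', one_mul]

section Convolution

variable {G : Type*} [AddCommGroup G] (S : Finset G) (w a : G → ℝ≥0∞) {α : ℝ}

lemma tsum_sum_mul_translate :
    ∑' u, ∑ s ∈ S, w s * a (u + s) = (∑ s ∈ S, w s) * ∑' j, a j := by
  rw [Summable.tsum_finsetSum fun _ _ => ENNReal.summable, Finset.sum_mul]
  refine Finset.sum_congr rfl fun s _ => ?_
  rw [ENNReal.tsum_mul_left, (Equiv.addRight s).tsum_eq a |>.symm]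
  rfl

lemma tsum_rpow_convolution_le_of_le_one (h0 : 0 < α) (h1 : α ≤ 1) :
    ∑' u, (∑ s ∈ S, w s * a (u + s)) ^ α ≤ (∑ s ∈ S, w s ^ α) * ∑' j, a j ^ α := by
  rw [← tsum_sum_mul_translate S (fun s => w s ^ α) fun j => a j ^ α]
  refine ENNReal.tsum_le_tsum fun u => (ENNReal.rpow_sum_le_sum_rpow S _ h0 h1).trans_eq ?_
  exact Finset.sum_congr rfl fun s _ => ENNReal.mul_rpow_of_nonneg _ _ h0.le

lemma tsum_rpow_convolution_le_of_one_le (h1 : 1 ≤ α) :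
    ∑' u, (∑ s ∈ S, w s * a (u + s)) ^ α ≤ (∑ s ∈ S, w s ^ α) * (∑' j, a j) ^ α := by
  have hA : ∀ u, ∑ s ∈ S, a (u + s) ≤ ∑' j, a j := fun u =>
    (ENNReal.sum_le_tsum S).trans_eq ((Equiv.addLeft u).tsum_eq a)
  calc ∑' u, (∑ s ∈ S, w s * a (u + s)) ^ α
      ≤ ∑' u, (∑' j, a j) ^ (α - 1) * ∑ s ∈ S, w s ^ α * a (u + s) := by
        refine ENNReal.tsum_le_tsum fun u => ?_
        simp only [mul_comm (w _), mul_comm (w _ ^ α)]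
        refine (ENNReal.rpow_sum_mul_le S (fun s => a (u + s)) w h1).trans ?_
        exact mul_le_mul_left (ENNReal.rpow_le_rpow (hA u) (by linarith)) _
    _ = (∑ s ∈ S, w s ^ α) * ((∑' j, a j) ^ (α - 1) * (∑' j, a j) ^ (1 : ℝ)) := by
        rw [ENNReal.tsum_mul_left, tsum_sum_mul_translate S (fun s => w s ^ α) a,
          ENNReal.rpow_one]
        ring
    _ = _ := by
        rw [← ENNReal.rpow_add_of_nonneg _ _ (by linarith) zero_le_one, sub_add_cancel]

end Convolution

lemma tendsto_lintegral_rpow_tsum_tail {W G : Type*} [MeasurableSpace W] [Countable G] [DecidableEq G]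
    (ν : Measure W) (f : W → G → ℝ≥0∞) (hf : ∀ j, Measurable fun v => f v j) {β : ℝ}
    (hβ : 0 < β) (hint : ∫⁻ v, (∑' j, f v j) ^ β ∂ν < ⊤) (F : ℕ → Finset G)
    (hF : Tendsto F atTop atTop) :
    Tendsto (fun T => ∫⁻ v, (∑' j, if j ∈ F T then 0 else f v j) ^ β ∂ν) atTop (nhds 0) := by
  have hmeas : Measurable fun v => (∑' j, f v j) ^ β :=
    (Measurable.tsum hf).pow_const β
  have hlim := tendsto_lintegral_of_dominated_convergence (μ := ν)
    (F := fun T v => (∑' j, if j ∈ F T then 0 else f v j) ^ β) (f := fun _ => 0)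
    (fun v => (∑' j, f v j) ^ β) (fun T => ?_) (fun T => ?_) hint.ne ?_
  · simpa using hlim
  · refine (Measurable.tsum fun j => ?_).pow_const β
    split_ifs
    · exact measurable_const
    · exact hf j
  · refine Eventually.of_forall fun v => ?_
    refine ENNReal.rpow_le_rpow (ENNReal.tsum_le_tsum fun j => ?_) hβ.le
    split_ifs <;> simp
  · filter_upwards [ae_lt_top hmeas hint.ne] with v hv
    have hfin : ∑' j, f v j ≠ ⊤ := by
      intro h
      rw [h, ENNReal.top_rpow_of_pos hβ] at hv
      exact lt_irrefl _ hv
    have h1 := (ENNReal.tendsto_tsum_compl_atTop_zero hfin).comp hF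
    have h2 := (ENNReal.continuous_rpow_const (y := β)).tendsto 0 |>.comp h1
    rw [ENNReal.zero_rpow_of_pos hβ] at h2
    refine h2.congr fun T => ?_
    simp only [Function.comp_apply]
    congr 1
    rw [← tsum_subtype_eq_of_support_subset (s := {j | j ∉ F T})]
    · exact tsum_congr fun j => (if_neg j.2).symm
    · intro j hj hjF
      exact hj (if_pos hjF)

lemma natCard_coset_inter_cube {d : ℕ} (K : AddSubgroup (Fin d → ℤ)) (n : ℕ)
    (s : (Fin d → ℤ) ⧸ K) :
    Nat.card {t : Fin d → ℤ | (Finset.univ.sup fun i => (t i).natAbs) ≤ n ∧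
      (QuotientAddGroup.mk t : (Fin d → ℤ) ⧸ K) = s} = cosetCount K n s := by
  rw [Nat.card_coe_set_eq, cosetCount, ← Set.ncard_coe_finset]
  congr 1
  ext t
  simp [mem_intCube_iff_sup_natAbs_le]

lemma tendsto_cosetCube {d : ℕ} (K : AddSubgroup (Fin d → ℤ)) :
    Tendsto (cosetCube K) atTop atTop := by
  refine tendsto_atTop_finset_of_monotone
    (fun a b hab => Finset.image_subset_image (intCube_mono _ hab)) fun g => ?_
  obtain ⟨t, rfl⟩ := QuotientAddGroup.mk_surjective g
  exact ⟨_, Finset.mem_image_of_mem _ (mem_intCube_iff_sup_natAbs_le.2 le_rfl)⟩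

lemma exists_sum_cosetCount_rpow_le {d r : ℕ} {K : AddSubgroup (Fin d → ℤ)}
    (e : K ≃+ (Fin r → ℤ)) (hr : r ≤ d) {α : ℝ} (hα : 0 ≤ α) :
    ∃ C : ℝ≥0∞, C ≠ ⊤ ∧ ∀ n : ℕ, 1 ≤ n →
      ∑ s ∈ cosetCube K n, (cosetCount K n s : ℝ≥0∞) ^ α ≤
        C * ENNReal.ofReal ((n : ℝ) ^ (((d - r : ℕ) : ℝ) + α * r)) := by
  obtain ⟨C₁, h₁⟩ := exists_cosetCount_le e
  obtain ⟨C₂, h₂⟩ := exists_card_cosetCube_le e hr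
  refine ⟨(C₂ : ℝ≥0∞) * (C₁ : ℝ≥0∞) ^ α,
    ENNReal.mul_ne_top (by simp) (ENNReal.rpow_ne_top_of_nonneg hα (by simp)), fun n hn => ?_⟩
  have hn0 : (0 : ℝ) < n := by exact_mod_cast hn
  have hn1 : (n : ℝ≥0∞) ≠ 0 := by
    simp only [ne_eq, Nat.cast_eq_zero]
    omega
  calc ∑ s ∈ cosetCube K n, (cosetCount K n s : ℝ≥0∞) ^ α
      ≤ ∑ s ∈ cosetCube K n, ((C₁ : ℝ≥0∞) * (n : ℝ≥0∞) ^ r) ^ α := by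
        refine Finset.sum_le_sum fun s _ => ENNReal.rpow_le_rpow ?_ hα
        exact_mod_cast h₁ n hn s
    _ = (cosetCube K n).card * ((C₁ : ℝ≥0∞) * (n : ℝ≥0∞) ^ r) ^ α := by
        rw [Finset.sum_const, nsmul_eq_mul]
    _ ≤ ((C₂ : ℝ≥0∞) * (n : ℝ≥0∞) ^ (d - r)) * ((C₁ : ℝ≥0∞) * (n : ℝ≥0∞) ^ r) ^ α := by
        gcongr
        exact_mod_cast h₂ n hn
    _ = _ := by
        rw [ENNReal.mul_rpow_of_nonneg _ _ hα, ← ENNReal.ofReal_rpow_of_pos hn0,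
          ENNReal.ofReal_natCast, ENNReal.rpow_add _ _ hn1 (by simp), mul_comm α,
          ENNReal.rpow_mul, ENNReal.rpow_natCast, ENNReal.rpow_natCast]
        ring

lemma ofReal_abs_sum_rpow_le {G : Type*} (S : Finset G) (f : G → ℝ) {α : ℝ} (hα : 0 ≤ α) :
    ENNReal.ofReal (|∑ s ∈ S, f s| ^ α) ≤ (∑ s ∈ S, ENNReal.ofReal |f s|) ^ α := by
  rw [← ENNReal.ofReal_rpow_of_nonneg (abs_nonneg _) hα,
    ← ENNReal.ofReal_sum_of_nonneg fun _ _ => abs_nonneg _]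
  exact ENNReal.rpow_le_rpow (ENNReal.ofReal_le_ofReal (Finset.abs_sum_le_sum_abs _ _)) hα

/-- Lemma 5.2 of the paper: with `G := ℤ^d/K`,
`N(g) := min{‖t‖∞ : t + K = g}`, `H_n := {g : N(g) ≤ n}`,
`m(s,n) := #{t : ‖t‖∞ ≤ n, t + K = s}`, and
`σ_{T,n}^α := ∫_W Σ_{u ∈ G} |Σ_{s ∈ H_n} m(s,n) h(v,u+s) 𝟙{N(u+s) > T}|^α ν(dv)`
(note `m(s,n) = 0` for `s ∉ H_n`), one has
`lim_{T→∞} limsup_{n→∞} σ_{T,n}^α / n^{p + α(d−p)} = 0`. -/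
theorem stmt_14 (d p : ℕ) (hp : 1 ≤ p) (hpd : p < d)
    (K : AddSubgroup (Fin d → ℤ)) (hK : Nonempty (K ≃+ (Fin (d - p) → ℤ)))
    {W : Type*} [MeasurableSpace W] (ν : Measure W) [SigmaFinite ν]
    (α : ℝ) (hα : α ∈ Set.Ioo (0 : ℝ) 2)
    (h : W → ((Fin d → ℤ) ⧸ K) → ℝ)
    (hmeas : ∀ j : (Fin d → ℤ) ⧸ K, Measurable fun v => h v j)
    (hint1 : ∫⁻ v, ∑' j : (Fin d → ℤ) ⧸ K, ENNReal.ofReal (|h v j| ^ α) ∂ν < ⊤)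
    (hint2 : ∫⁻ v, (∑' j : (Fin d → ℤ) ⧸ K, ENNReal.ofReal |h v j|) ^ α ∂ν < ⊤)
    (N : ((Fin d → ℤ) ⧸ K) → ℕ)
    (hN : ∀ g : (Fin d → ℤ) ⧸ K,
      N g = sInf ((fun t : Fin d → ℤ => Finset.univ.sup fun i => (t i).natAbs) ''
        {t : Fin d → ℤ | (QuotientAddGroup.mk t : (Fin d → ℤ) ⧸ K) = g}))
    (m : ((Fin d → ℤ) ⧸ K) → ℕ → ℕ)
    (hm : ∀ (s : (Fin d → ℤ) ⧸ K) (n : ℕ),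
      m s n = Nat.card {t : Fin d → ℤ |
        (Finset.univ.sup fun i => (t i).natAbs) ≤ n ∧
        (QuotientAddGroup.mk t : (Fin d → ℤ) ⧸ K) = s})
    (σ : ℕ → ℕ → ℝ≥0∞)
    (hσ : ∀ T n : ℕ, σ T n = ∫⁻ v, ∑' u : (Fin d → ℤ) ⧸ K,
      ENNReal.ofReal (|∑' s : (Fin d → ℤ) ⧸ K,
        (m s n : ℝ) * h v (u + s) * (if T < N (u + s) then 1 else 0)| ^ α) ∂ν) :
    Tendsto (fun T : ℕ =>
        limsup (fun n : ℕ =>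
          σ T n / ENNReal.ofReal ((n : ℝ) ^ ((p : ℝ) + α * ((d : ℝ) - (p : ℝ))))) atTop)
      atTop (nhds 0) := by
  obtain ⟨e⟩ := hK
  have hα0 := hα.1
  have : Countable ((Fin d → ℤ) ⧸ K) := QuotientAddGroup.mk_surjective.countable
  obtain ⟨C, hC, hCn⟩ := exists_sum_cosetCount_rpow_le e (Nat.sub_le d p) hα0.le
  have hNle : ∀ T, ∀ g ∈ cosetCube K T, N g ≤ T := by
    intro T g hg
    obtain ⟨t, ht, rfl⟩ := Finset.mem_image.1 hg
    rw [hN]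
    refine (Nat.sInf_le (Set.mem_image_of_mem _ ?_)).trans (mem_intCube_iff_sup_natAbs_le.1 ht)
    rfl
  have hmc : ∀ s n, m s n = cosetCount K n s := fun s n => by
    rw [hm, natCard_coset_inter_cube]
  have hF := tendsto_cosetCube K
  have hmeas' : ∀ j : (Fin d → ℤ) ⧸ K, Measurable fun v => ENNReal.ofReal |h v j| :=
    fun j => (continuous_abs.measurable.comp (hmeas j)).ennreal_ofReal
  let a : ℕ → W → (Fin d → ℤ) ⧸ K → ℝ≥0∞ := fun T v j =>
    if j ∈ cosetCube K T then 0 else ENNReal.ofReal |h v j|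
  have hpt : ∀ T n v (u : (Fin d → ℤ) ⧸ K), ENNReal.ofReal (|∑' s : (Fin d → ℤ) ⧸ K,
      (m s n : ℝ) * h v (u + s) * (if T < N (u + s) then 1 else 0)| ^ α) ≤
      (∑ s ∈ cosetCube K n, (cosetCount K n s : ℝ≥0∞) * a T v (u + s)) ^ α := by
    intro T n v u
    rw [tsum_eq_sum (s := cosetCube K n) fun s hs => by
      rw [hmc, cosetCount_eq_zero hs]
      simp]
    refine (ofReal_abs_sum_rpow_le _ _ hα0.le).trans
      (ENNReal.rpow_le_rpow (Finset.sum_le_sum fun s _ => ?_) hα0.le)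
    rw [hmc]
    by_cases hs : u + s ∈ cosetCube K T
    · simp [not_lt.2 (hNle T _ hs)]
    · simp only [a, if_neg hs]
      rw [← ENNReal.ofReal_natCast, ← ENNReal.ofReal_mul (Nat.cast_nonneg _)]
      refine ENNReal.ofReal_le_ofReal ?_
      rw [abs_mul, abs_mul, Nat.abs_cast]
      refine mul_le_of_le_one_right (by positivity) ?_
      split_ifs <;> simp
  obtain ⟨I, hI0, hI⟩ : ∃ I : ℕ → ℝ≥0∞, Tendsto I atTop (nhds 0) ∧ ∀ T n,
      σ T n ≤ (∑ s ∈ cosetCube K n, (cosetCount K n s : ℝ≥0∞) ^ α) * I T := by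
    have hfin : ∀ n, ∑ s ∈ cosetCube K n, (cosetCount K n s : ℝ≥0∞) ^ α ≠ ⊤ := fun n =>
      ENNReal.sum_ne_top.2 fun s _ => ENNReal.rpow_ne_top_of_nonneg hα0.le (by simp)
    rcases le_total α 1 with h1 | h1
    · refine ⟨fun T => ∫⁻ v, (∑' j, if j ∈ cosetCube K T then 0 else
        ENNReal.ofReal (|h v j| ^ α)) ^ (1 : ℝ) ∂ν, ?_, fun T n => ?_⟩
      · refine tendsto_lintegral_rpow_tsum_tail ν (fun v j => ENNReal.ofReal (|h v j| ^ α))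
          (fun j => ?_) one_pos ?_ (cosetCube K) hF
        · simp only [← ENNReal.ofReal_rpow_of_nonneg (abs_nonneg _) hα0.le]
          exact (hmeas' j).pow_const α
        · simp only [ENNReal.rpow_one]
          exact hint1
      · rw [hσ, ← lintegral_const_mul' _ _ (hfin n)]
        refine lintegral_mono fun v => (ENNReal.tsum_le_tsum (hpt T n v)).trans
          ((tsum_rpow_convolution_le_of_le_one _ _ _ hα0 h1).trans_eq ?_)
        rw [ENNReal.rpow_one]
        congr 1
        refine tsum_congr fun j => ?_
        simp only [a]
        split_ifs
        · exact ENNReal.zero_rpow_of_pos hα0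
        · exact ENNReal.ofReal_rpow_of_nonneg (abs_nonneg _) hα0.le
    · refine ⟨fun T => ∫⁻ v, (∑' j, a T v j) ^ α ∂ν, tendsto_lintegral_rpow_tsum_tail ν
        (fun v j => ENNReal.ofReal |h v j|) hmeas' hα0 hint2 (cosetCube K) hF, fun T n => ?_⟩
      rw [hσ, ← lintegral_const_mul' _ _ (hfin n)]
      exact lintegral_mono fun v => (ENNReal.tsum_le_tsum (hpt T n v)).trans
        (tsum_rpow_convolution_le_of_one_le _ _ _ h1)
  have hlim : Tendsto (fun T => C * I T) atTop (nhds 0) := by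
    simpa using ENNReal.Tendsto.const_mul hI0 (Or.inr hC)
  refine tendsto_of_tendsto_of_tendsto_of_le_of_le tendsto_const_nhds hlim
    (fun _ => zero_le) fun T => ?_
  refine limsup_le_of_le (by isBoundedDefault) ?_
  filter_upwards [eventually_ge_atTop 1] with n hn
  refine ENNReal.div_le_of_le_mul ((hI T n).trans ?_)
  have h2 := hCn n hn
  rw [Nat.sub_sub_self hpd.le, Nat.cast_sub hpd.le] at h2
  calc _ ≤ _ := mul_le_mul_left h2 _
    _ = _ := by ring
end
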